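/- Let X be a Polish space and A ⊆ X. Then there exists an EBP-set B ⊇ A such that for every EBP-set E with A ⊆ E, the set B ∖ E is residually null; moreover B can be chosen to be the union of a closed set with a residually null set. -/

import Mathlib

open MeasureTheory Set Topology
open scoped ENNReal symmDiff

/-- The annihilator of a set `A`: the set of Borel probability measures `μ` on `X`
whose induced outer measure vanishes on `A`. -/
def Annihilator {X : Type*} [MeasurableSpace X] (A : Set X) :
    Set (ProbabilityMeasure X) :=
  {μ : ProbabilityMeasure X | μ.toMeasure A = 0}

/-- `A` is residually null if its annihilator is comeager in the space `𝓜(X)` of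
Borel probability measures with the topology of weak convergence. -/
def ResiduallyNull {X : Type*} [TopologicalSpace X] [MeasurableSpace X]
    [OpensMeasurableSpace X] (A : Set X) : Prop :=
  Annihilator A ∈ residual (ProbabilityMeasure X)

/-- `A` is an EBP-set (extended Baire property) if its symmetric difference with some
open set is residually null. -/
def EBPSet {X : Type*} [TopologicalSpace X] [MeasurableSpace X]
    [OpensMeasurableSpace X] (A : Set X) : Prop :=
  ∃ U : Set X, IsOpen U ∧ ResiduallyNull (A ∆ U)

/-- Subsets of residually null sets are residually null. -/
theorem ResiduallyNull.mono {X : Type*} [TopologicalSpace X] [MeasurableSpace X]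
    [OpensMeasurableSpace X] {A B : Set X} (hB : ResiduallyNull B) (h : A ⊆ B) :
    ResiduallyNull A :=
  Filter.mem_of_superset hB fun _ hμ => measure_mono_null h hμ

/-- The union of a countable family of residually null sets is residually null. -/
theorem residuallyNull_sUnion {X : Type*} [TopologicalSpace X] [MeasurableSpace X]
    [OpensMeasurableSpace X] {S : Set (Set X)} (hS : S.Countable)
    (h : ∀ A ∈ S, ResiduallyNull A) : ResiduallyNull (⋃₀ S) := by
  have := (countable_bInter_mem (l := residual (ProbabilityMeasure X))
    (s := fun A _ => Annihilator A) hS).2 h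
  refine Filter.mem_of_superset this fun μ hμ => ?_
  rw [mem_iInter₂] at hμ
  exact (measure_sUnion_null_iff hS).2 hμ

theorem ResiduallyNull.union {X : Type*} [TopologicalSpace X] [MeasurableSpace X]
    [OpensMeasurableSpace X] {A B : Set X} (hA : ResiduallyNull A) (hB : ResiduallyNull B) :
    ResiduallyNull (A ∪ B) := by
  filter_upwards [hA, hB] with μ h₁ h₂ using measure_union_null h₁ h₂

/-- Evaluation on a closed set is upper semicontinuous for weak convergence. -/
theorem isOpen_setOf_measure_lt_of_isClosed {X : Type*} [TopologicalSpace X]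
    [MeasurableSpace X] [OpensMeasurableSpace X] [HasOuterApproxClosed X] {C : Set X}
    (hC : IsClosed C) (ε : ℝ≥0∞) :
    IsOpen {μ : ProbabilityMeasure X | μ.toMeasure C < ε} := by
  refine isOpen_iff_mem_nhds.2 fun μ hμ => ?_
  have h := ProbabilityMeasure.limsup_measure_closed_le_of_tendsto
    (L := 𝓝 μ) (μs := fun ν => ν) Filter.tendsto_id hC
  exact Filter.eventually_lt_of_limsup_lt (h.trans_lt hμ)

/-- The probability measures concentrated on a dense measurable set are dense. -/
theorem dense_annihilator_compl {X : Type*} [TopologicalSpace X] [PolishSpace X]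
    [MeasurableSpace X] [BorelSpace X] {D : Set X} (hD : Dense D) (hm : MeasurableSet D) :
    Dense (Annihilator Dᶜ) := by
  let _ := TopologicalSpace.upgradeIsCompletelyMetrizable X
  intro μ
  have : Nonempty X := μ.nonempty
  obtain ⟨y, hy⟩ := hD.nonempty
  let f : ℕ → SimpleFunc X X := SimpleFunc.approxOn id measurable_id D y hy
  have hf : ∀ n, AEMeasurable (f n) (μ : Measure X) := fun n => (f n).measurable.aemeasurable
  refine mem_closure_of_tendsto (f := fun n => μ.map (hf n)) (b := Filter.atTop) ?_
    (Filter.Eventually.of_forall fun n => ?_)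
  · refine ProbabilityMeasure.tendsto_iff_forall_integral_tendsto.2 fun g => ?_
    simp only [ProbabilityMeasure.toMeasure_map]
    have hint : ∀ n, ∫ x, g x ∂((μ : Measure X).map (f n)) = ∫ x, g (f n x) ∂(μ : Measure X) :=
      fun n => integral_map (hf n) g.continuous.measurable.aestronglyMeasurable
    simp only [hint]
    refine tendsto_integral_of_dominated_convergence (fun _ => ‖g‖)
      (fun n => (g.continuous.measurable.comp (f n).measurable).aestronglyMeasurable)
      (integrable_const _) (fun n => ae_of_all _ fun x => g.norm_coe_le_norm _)
      (ae_of_all _ fun x => ?_)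
    exact (g.continuous.tendsto x).comp
      (SimpleFunc.tendsto_approxOn measurable_id hy (hD.closure_eq ▸ mem_univ x))
  · change ((μ.map (hf n) : ProbabilityMeasure X) : Measure X) Dᶜ = 0
    rw [ProbabilityMeasure.toMeasure_map, Measure.map_apply (f n).measurable hm.compl]
    have : f n ⁻¹' Dᶜ = ∅ := eq_empty_of_forall_notMem fun x hx =>
      hx (SimpleFunc.approxOn_mem measurable_id hy n x)
    rw [this, measure_empty]

/-- Closed sets with empty interior are residually null. -/
theorem IsClosed.residuallyNull {X : Type*} [TopologicalSpace X] [PolishSpace X]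
    [MeasurableSpace X] [BorelSpace X] {C : Set X} (hC : IsClosed C) (h : interior C = ∅) :
    ResiduallyNull C := by
  have hd : Dense (Annihilator C) := by
    simpa using dense_annihilator_compl (interior_eq_empty_iff_dense_compl.1 h)
      hC.measurableSet.compl
  have ho (n : ℕ) : {μ : ProbabilityMeasure X | μ.toMeasure C < (n : ℝ≥0∞)⁻¹} ∈
      residual (ProbabilityMeasure X) := by
    let _ := TopologicalSpace.upgradeIsCompletelyMetrizable X
    refine residual_of_dense_open (isOpen_setOf_measure_lt_of_isClosed hC _) (hd.mono ?_)
    intro μ hμ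
    have hμ : μ.toMeasure C = 0 := hμ
    simp [hμ]
  refine Filter.mem_of_superset (countable_iInter_mem.2 ho) fun μ hμ => ?_
  rw [mem_iInter] at hμ
  by_contra hne
  obtain ⟨n, hn⟩ := ENNReal.exists_inv_nat_lt hne
  exact (hn.trans (hμ n)).false

/-- Every set `A` admits a largest open set `U` such that `A ∩ U` is residually null. -/
theorem exists_isOpen_residuallyNull_inter {X : Type*} [TopologicalSpace X]
    [SecondCountableTopology X] [MeasurableSpace X] [OpensMeasurableSpace X] (A : Set X) :
    ∃ U : Set X, IsOpen U ∧ ResiduallyNull (A ∩ U) ∧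
      ∀ V : Set X, IsOpen V → ResiduallyNull (A ∩ V) → V ⊆ U := by
  let S := {V ∈ TopologicalSpace.countableBasis X | ResiduallyNull (A ∩ V)}
  have hS : S.Countable := (TopologicalSpace.countable_countableBasis X).mono (sep_subset _ _)
  refine ⟨⋃₀ S, isOpen_sUnion fun V hV => TopologicalSpace.isOpen_of_mem_countableBasis hV.1,
    ?_, fun V hV hAV x hx => ?_⟩
  · refine (residuallyNull_sUnion (hS.image (A ∩ ·)) ?_).mono ?_
    · rintro _ ⟨V, hV, rfl⟩
      exact hV.2
    · rintro x ⟨hxA, V, hV, hxV⟩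
      exact ⟨A ∩ V, mem_image_of_mem _ hV, hxA, hxV⟩
  · obtain ⟨W, hW, hxW, hWV⟩ :=
      (TopologicalSpace.isBasis_countableBasis X).exists_subset_of_mem_open hx hV
    exact ⟨W, ⟨hW, hAV.mono (inter_subset_inter_right A hWV)⟩, hxW⟩

/-- Covering lemma: for any `A ⊆ X` there is an EBP-set `B ⊇ A` such that `B \ E` is
residually null for every EBP-set `E ⊇ A`; moreover `B` may be taken to be the union of
a closed set with a residually null set. -/
theorem ebp_covering {X : Type*} [TopologicalSpace X] [PolishSpace X]
    [MeasurableSpace X] [BorelSpace X] (A : Set X) :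
    ∃ B : Set X, A ⊆ B ∧ EBPSet B ∧
      (∀ E : Set X, EBPSet E → A ⊆ E → ResiduallyNull (B \ E)) ∧
      ∃ F N : Set X, IsClosed F ∧ ResiduallyNull N ∧ B = F ∪ N := by
  obtain ⟨U, hU, hAU, hmax⟩ := exists_isOpen_residuallyNull_inter A
  have hF : IsClosed Uᶜ := hU.isClosed_compl
  refine ⟨Uᶜ ∪ A ∩ U, ?_, ⟨interior Uᶜ, isOpen_interior, ?_⟩, ?_, Uᶜ, A ∩ U, hF, hAU, rfl⟩
  · intro x hx
    by_cases h : x ∈ U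
    exacts [Or.inr ⟨hx, h⟩, Or.inl h]
  · refine ((isClosed_frontier.residuallyNull (interior_frontier hF)).union hAU).mono ?_
    rw [hF.frontier_eq]
    rintro x (⟨hx | hx, hi⟩ | ⟨hi, hx⟩)
    exacts [Or.inl ⟨hx, hi⟩, Or.inr hx, absurd (Or.inl (interior_subset hi)) hx]
  · rintro E ⟨V, hV, hEV⟩ hAE
    have hint : interior (Uᶜ \ V) = ∅ := by
      refine eq_empty_of_forall_notMem fun x hx => (interior_subset hx).1 ?_
      refine hmax _ isOpen_interior (hEV.mono ?_) hx
      rintro y ⟨hyA, hy⟩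
      exact Or.inl ⟨hAE hyA, (interior_subset hy).2⟩
    refine ((((hF.sdiff hV).residuallyNull hint).union hAU).union hEV).mono ?_
    rintro x ⟨hx | hx, hxE⟩
    · by_cases hxV : x ∈ V
      exacts [Or.inr (Or.inr ⟨hxV, hxE⟩), Or.inl (Or.inl ⟨hx, hxV⟩)]
    · exact Or.inl (Or.inr hx)
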